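/- Let E be a complete real normed vector space (a real Banach space), let f : E → E be Lipschitz with constant k where 0 ≤ k < 1, let q* be the unique fixed point of f, and let β satisfy 0 < β < 2/(k+1). Let (y_n, z_n) be the sequence generated by the reversible fixed-point iteration from any initial pair (y_0, z_0), and set L = |1−β| + β·k. Then for all n ≥ 0, max(‖y_n − q*‖, ‖z_n − q*‖) ≤ L^n · max(‖y_0 − q*‖, ‖z_0 − q*‖); i.e. the iteration converges linearly to (q*, q*) with rate L in the max norm on E × E. -/

import Mathlib

/-- A relaxed step `(1 - β) • u + β • f v` stays within `(|1 - β| + β * k) * M` of a fixed point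
of the `k`-Lipschitz map `f` when `u` and `v` are within `M` of it. -/
lemma norm_relaxed_step_sub_le {E : Type*} [NormedAddCommGroup E] [NormedSpace ℝ E]
    {f : E → E} {k : ℝ} (hk : 0 ≤ k) (hf : ∀ a b : E, ‖f a - f b‖ ≤ k * ‖a - b‖)
    {q : E} (hq : f q = q) {β : ℝ} (hβ : 0 ≤ β) {u v : E} {M : ℝ}
    (hu : ‖u - q‖ ≤ M) (hv : ‖v - q‖ ≤ M) :
    ‖(1 - β) • u + β • f v - q‖ ≤ (|1 - β| + β * k) * M := by
  have hsplit : (1 - β) • u + β • f v - q = (1 - β) • (u - q) + β • (f v - f q) := by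
    rw [hq]; module
  calc ‖(1 - β) • u + β • f v - q‖
      ≤ |1 - β| * ‖u - q‖ + β * ‖f v - f q‖ := by
        rw [hsplit]
        refine (norm_add_le _ _).trans_eq ?_
        rw [norm_smul, norm_smul, Real.norm_eq_abs, Real.norm_eq_abs, abs_of_nonneg hβ]
    _ ≤ |1 - β| * M + β * (k * M) := by
        gcongr
        exact (hf v q).trans (by gcongr)
    _ = (|1 - β| + β * k) * M := by ring

/-- The rate `|1 - β| + β * k` is less than one for `0 < β < 2 / (k + 1)`. -/
lemma abs_one_sub_add_mul_lt_one {k β : ℝ} (hk0 : 0 ≤ k) (hk1 : k < 1)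
    (hβ0 : 0 < β) (hβ2 : β < 2 / (k + 1)) : |1 - β| + β * k < 1 := by
  have hβk : β * (k + 1) < 2 := (lt_div_iff₀ (by positivity)).1 hβ2
  have habs : |1 - β| < 1 - β * k := abs_lt.2 ⟨by linarith, by nlinarith⟩
  linarith

/-- Linear convergence of the reversible fixed-point iteration in the max norm:
`max(‖y_n − q*‖, ‖z_n − q*‖) ≤ L^n · max(‖y_0 − q*‖, ‖z_0 − q*‖)`
with `L = |1−β| + β·k`. -/
theorem reversible_iteration_linear_convergence {E : Type*} [NormedAddCommGroup E]
    [NormedSpace ℝ E] [CompleteSpace E]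
    (f : E → E) (k : ℝ) (hk0 : 0 ≤ k) (hk1 : k < 1)
    (hf : ∀ a b : E, ‖f a - f b‖ ≤ k * ‖a - b‖)
    (qstar : E) (hq : f qstar = qstar)
    (β : ℝ) (hβ0 : 0 < β) (hβ2 : β < 2 / (k + 1))
    (y z : ℕ → E)
    (hy : ∀ n, y (n + 1) = (1 - β) • y n + β • f (z n))
    (hz : ∀ n, z (n + 1) = (1 - β) • z n + β • f (y (n + 1)))
    (L : ℝ) (hL : L = |1 - β| + β * k) :
    ∀ n : ℕ,
      max ‖y n - qstar‖ ‖z n - qstar‖ ≤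
        L ^ n * max ‖y 0 - qstar‖ ‖z 0 - qstar‖ := by
  have hL0 : 0 ≤ L := hL ▸ by positivity
  have hL1 : L ≤ 1 := hL ▸ (abs_one_sub_add_mul_lt_one hk0 hk1 hβ0 hβ2).le
  intro n
  induction n with
  | zero => simp
  | succ n ih =>
    set M := max ‖y n - qstar‖ ‖z n - qstar‖
    have hyM : ‖y n - qstar‖ ≤ M := le_max_left _ _
    have hzM : ‖z n - qstar‖ ≤ M := le_max_right _ _
    have hM0 : 0 ≤ M := (norm_nonneg _).trans hyM
    have hy' : ‖y (n + 1) - qstar‖ ≤ L * M := by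
      rw [hy, hL]
      exact norm_relaxed_step_sub_le hk0 hf hq hβ0.le hyM hzM
    have hz' : ‖z (n + 1) - qstar‖ ≤ L * M := by
      rw [hz, hL]
      exact norm_relaxed_step_sub_le hk0 hf hq hβ0.le hzM
        (hy'.trans (mul_le_of_le_one_left hM0 hL1))
    calc max ‖y (n + 1) - qstar‖ ‖z (n + 1) - qstar‖ ≤ L * M := max_le hy' hz'
      _ ≤ L * (L ^ n * max ‖y 0 - qstar‖ ‖z 0 - qstar‖) := by gcongr
      _ = L ^ (n + 1) * max ‖y 0 - qstar‖ ‖z 0 - qstar‖ := by ring
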